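/- arXiv:1705.00038 — 2 statements merged into one kernel-verified Lean document; each statement's English description precedes it below -/
import Mathlib

section
/- Let X ⊆ ℝ^m contain 0, and suppose X has a unique tangent cone T₀X at 0. If X is Lipschitz normally embedded with constant λ, then for any unit vectors v, w ∈ T₀X, the inner distance in T₀X satisfies d_{T₀X}(v,w) ≤ λ‖v - w‖. -/
open Set Filter Metric

/-- Length of a path `γ : [0,1] → E` measured via the (extended) variation. -/
noncomputable def pathLength {E : Type*} [NormedAddCommGroup E] (γ : ℝ → E) : ENNReal :=
  eVariationOn γ (Set.Icc 0 1)

/-- `γ` is a path in `X` from `x` to `y`, parametrized on `[0,1]`. -/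
def IsPathIn {E : Type*} [NormedAddCommGroup E] (X : Set E) (x y : E) (γ : ℝ → E) : Prop :=
  ContinuousOn γ (Set.Icc 0 1) ∧ Set.MapsTo γ (Set.Icc 0 1) X ∧ γ 0 = x ∧ γ 1 = y

/-- The inner (length) distance on `X`: the infimum of the lengths of paths in `X`
joining `x` to `y`. -/
noncomputable def innerDist {E : Type*} [NormedAddCommGroup E] (X : Set E) (x y : E) : ENNReal :=
  ⨅ γ ∈ {γ : ℝ → E | IsPathIn X x y γ}, pathLength γ

/-- The set of directions of `X` at `p` with respect to the sequence `t`. -/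
def dirSeqAt {E : Type*} [NormedAddCommGroup E] [NormedSpace ℝ E]
    (X : Set E) (p : E) (t : ℕ → ℝ) : Set E :=
  {v | ∃ x : ℕ → E, ∃ j₀ : ℕ, (∀ j, x j ∈ X \ {p}) ∧ (∀ j ≥ j₀, ‖x j - p‖ = t j) ∧
    Filter.Tendsto (fun j => (t j)⁻¹ • (x j - p)) Filter.atTop (nhds v)}

/-- `ρ_m⁻¹(X \ {0})`, viewed inside the ambient space `E × ℝ` (the blow-up
`S^{m-1} × [0,∞)` sits inside `E × ℝ` as `{(x, r) : ‖x‖ = 1, r ≥ 0}`,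
and `ρ_m (x, r) = r • x`). -/
def blowupPre {E : Type*} [NormedAddCommGroup E] [NormedSpace ℝ E] (X : Set E) :
    Set (E × ℝ) :=
  {q | ‖q.1‖ = 1 ∧ 0 < q.2 ∧ q.2 • q.1 ∈ X \ {0}}

/-- The cone (with vertex `0`) over a set of directions `D`. -/
def coneOver {E : Type*} [NormedAddCommGroup E] [NormedSpace ℝ E] (D : Set E) : Set E :=
  {p | ∃ t : ℝ, 0 ≤ t ∧ ∃ v ∈ D, p = t • v}

lemma aux_reparam {E : Type*} [NormedAddCommGroup E] (X : Set E) (x y : E) (γ : ℝ → E)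
    (hγ : IsPathIn X x y γ) (L : ℝ) (hL : 0 ≤ L) (hlen : pathLength γ ≤ ENNReal.ofReal L) :
    ∃ β : ℝ → E, β 0 = x ∧ β 1 = y ∧ (∀ s ∈ Icc (0:ℝ) 1, β s ∈ X) ∧
      ∀ a b, 0 ≤ a → a ≤ b → b ≤ 1 → dist (β a) (β b) ≤ L * (b - a) := by
  obtain ⟨hc, hm, h0, h1⟩ := hγ
  have hbv : eVariationOn γ (Icc 0 1) ≠ ⊤ := ne_top_of_le_ne_top ENNReal.ofReal_ne_top hlen
  set V : ℝ → ℝ := fun t => (eVariationOn γ (Icc 0 t)).toReal with hV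
  have hfin : ∀ a b, 0 ≤ a → b ≤ 1 → eVariationOn γ (Icc a b) ≠ ⊤ := fun a b ha hb =>
    ne_top_of_le_ne_top hbv (eVariationOn.mono γ (Icc_subset_Icc ha hb))
  have hVd : ∀ a b, 0 ≤ a → a ≤ b → b ≤ 1 → dist (γ a) (γ b) ≤ V b - V a := by
    intro a b ha hab hb
    have h := eVariationOn.Icc_add_Icc γ (s := univ) ha hab (mem_univ a)
    simp only [univ_inter] at h
    have h2 : V b = V a + (eVariationOn γ (Icc a b)).toReal := by
      simp only [hV]
      rw [← h, ENNReal.toReal_add (hfin 0 a le_rfl (hab.trans hb)) (hfin a b ha hb)]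
    have h3 : edist (γ a) (γ b) ≤ eVariationOn γ (Icc a b) :=
      eVariationOn.edist_le γ ⟨le_rfl, hab⟩ ⟨hab, le_rfl⟩
    have h4 := ENNReal.toReal_mono (hfin a b ha hb) h3
    rw [← dist_edist] at h4
    linarith
  have hV0 : V 0 = 0 := by simp [hV, eVariationOn.subsingleton]
  have hV1 : V 1 ≤ L := ENNReal.toReal_le_of_le_ofReal hL hlen
  have hVmono : ∀ a b, 0 ≤ a → a ≤ b → b ≤ 1 → V a ≤ V b := fun a b h1 h2 h3 => by
    have := hVd a b h1 h2 h3
    have := dist_nonneg (x := γ a) (y := γ b)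
    linarith
  set S : ℝ → Set ℝ := fun σ => {t | t ∈ Icc (0:ℝ) 1 ∧ V t ≤ L * σ} with hS
  have hSb : ∀ σ, BddAbove (S σ) := fun σ => ⟨1, fun t ht => ht.1.2⟩
  have hS0 : ∀ σ, 0 ≤ σ → (0:ℝ) ∈ S σ := fun σ hσ =>
    ⟨⟨le_rfl, zero_le_one⟩, by rw [hV0]; positivity⟩
  set τ : ℝ → ℝ := fun σ => sSup (S σ) with hτ
  have hτ0 : ∀ σ, 0 ≤ σ → 0 ≤ τ σ := fun σ hσ => le_csSup (hSb σ) (hS0 σ hσ)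
  have hτ1 : ∀ σ, 0 ≤ σ → τ σ ≤ 1 := fun σ hσ => csSup_le ⟨0, hS0 σ hσ⟩ fun t ht => ht.1.2
  have hτlt : ∀ σ t, 0 ≤ σ → 0 ≤ t → t < τ σ → V t ≤ L * σ := by
    intro σ t hσ ht htt
    obtain ⟨u, hu, htu⟩ := exists_lt_of_lt_csSup ⟨0, hS0 σ hσ⟩ htt
    exact (hVmono t u ht htu.le hu.1.2).trans hu.2
  have hτgt : ∀ σ t, 0 ≤ σ → t ≤ 1 → τ σ < t → L * σ < V t := by
    intro σ t hσ ht htt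
    by_contra hcon
    exact absurd (le_csSup (hSb σ) (show t ∈ S σ from
      ⟨⟨(hτ0 σ hσ).trans htt.le, ht⟩, not_lt.1 hcon⟩)) (not_le.2 htt)
  -- generic limiting estimate
  have key : ∀ a b C, 0 ≤ a → a < b → b ≤ 1 →
      (∀ t t', a < t → t < t' → t' < b → dist (γ t) (γ t') ≤ C) → dist (γ a) (γ b) ≤ C := by
    intro a b C ha hab hb h
    have e1 : Tendsto (fun ε : ℝ => γ (a + ε)) (nhdsWithin 0 (Ioo 0 ((b-a)/2))) (nhds (γ a)) := by
      have := hc a ⟨ha, hab.le.trans hb⟩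
      refine this.tendsto.comp (tendsto_nhdsWithin_iff.2 ⟨?_, ?_⟩)
      · refine Tendsto.mono_left ?_ nhdsWithin_le_nhds
        exact Continuous.tendsto' (by fun_prop) _ _ (by simp)
      · filter_upwards [self_mem_nhdsWithin] with ε hε
        exact ⟨by linarith [hε.1], by linarith [hε.2]⟩
    have e2 : Tendsto (fun ε : ℝ => γ (b - ε)) (nhdsWithin 0 (Ioo 0 ((b-a)/2))) (nhds (γ b)) := by
      have := hc b ⟨ha.trans hab.le, hb⟩
      refine this.tendsto.comp (tendsto_nhdsWithin_iff.2 ⟨?_, ?_⟩)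
      · refine Tendsto.mono_left ?_ nhdsWithin_le_nhds
        exact Continuous.tendsto' (by fun_prop) _ _ (by simp)
      · filter_upwards [self_mem_nhdsWithin] with ε hε
        exact ⟨by linarith [hε.2], by linarith [hε.1]⟩
    have hne : (nhdsWithin (0:ℝ) (Ioo 0 ((b-a)/2))).NeBot :=
      left_nhdsWithin_Ioo_neBot (by linarith)
    refine le_of_tendsto (e1.dist e2) ?_
    filter_upwards [self_mem_nhdsWithin] with ε hε
    exact h _ _ (by linarith [hε.1]) (by linarith [hε.2]) (by linarith [hε.1])
  refine ⟨fun σ => γ (τ σ), ?_, ?_, ?_, ?_⟩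
  · rcases (hτ0 0 le_rfl).eq_or_lt with h | h
    · simp only [← h, h0]
    · have := key 0 (τ 0) 0 le_rfl h (hτ1 0 le_rfl) (by
        intro t t' ht htt ht'
        have a1 := hVd t t' ht.le htt.le (ht'.le.trans (hτ1 0 le_rfl))
        have a2 := hτlt 0 t' le_rfl (ht.trans htt).le ht'
        have a3 := hVmono 0 t le_rfl ht.le ((htt.trans ht').le.trans (hτ1 0 le_rfl))
        rw [hV0] at a3
        linarith)
      have := dist_le_zero.1 this
      simp only [← this, h0]
  · have : τ 1 = 1 := le_antisymm (hτ1 1 zero_le_one)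
      (le_csSup (hSb 1) ⟨⟨zero_le_one, le_rfl⟩, by linarith⟩)
    simp only [this, h1]
  · intro s hs
    exact hm ⟨hτ0 s hs.1, hτ1 s hs.1⟩
  · intro a b ha hab hb
    have hb0 := ha.trans hab
    have hle : τ a ≤ τ b := csSup_le_csSup (hSb b) ⟨0, hS0 a ha⟩ fun t ht =>
      ⟨ht.1, ht.2.trans (mul_le_mul_of_nonneg_left hab hL)⟩
    rcases hle.eq_or_lt with h | h
    · simp only [h, dist_self]
      exact mul_nonneg hL (by linarith)
    · refine key _ _ _ (hτ0 a ha) h (hτ1 b hb0) ?_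
      intro t t' ht htt ht'
      have ht0 := (hτ0 a ha).trans ht.le
      have ht1 := ht'.le.trans (hτ1 b hb0)
      have a1 := hVd t t' ht0 htt.le ht1
      have a2 := hτlt b t' hb0 (ht0.trans htt.le) ht'
      have a3 := hτgt a t ha (htt.le.trans ht1) ht
      linarith

lemma aux_mem {E : Type*} [NormedAddCommGroup E] [NormedSpace ℝ E] (X T : Set E)
    (hT : ∀ t : ℕ → ℝ, (∀ j, 0 < t j) → Filter.Tendsto t Filter.atTop (nhds 0) →
      coneOver (dirSeqAt X 0 t) = T) (h0 : (0:E) ∈ T)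
    (s : ℕ → ℝ) (hs : ∀ j, 0 < s j) (hs0 : Tendsto s atTop (nhds 0))
    (z : ℕ → E) (hz : ∀ j, z j ∈ X) (p : E)
    (hp : Tendsto (fun j => (s j)⁻¹ • z j) atTop (nhds p)) : p ∈ T := by
  by_cases hp0 : p = 0
  · rwa [hp0]
  have hev : ∀ᶠ j in atTop, (s j)⁻¹ • z j ≠ 0 := hp.eventually_ne hp0
  obtain ⟨N, hN⟩ := eventually_atTop.1 hev
  have hzn : ∀ j, z (j + N) ≠ 0 := fun j h => hN (j + N) (by omega) (by simp [h])
  have hn : ∀ j, ‖z j‖ = s j * ‖(s j)⁻¹ • z j‖ := fun j => by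
    rw [norm_smul, norm_inv, Real.norm_of_nonneg (hs j).le, ← mul_assoc,
      mul_inv_cancel₀ (hs j).ne', one_mul]
  have ht0 : Tendsto (fun j => ‖z j‖) atTop (nhds 0) := by
    simp_rw [hn]
    simpa using hs0.mul hp.norm
  rw [← hT (fun j => ‖z (j + N)‖) (fun j => norm_pos_iff.2 (hzn j))
    ((tendsto_add_atTop_iff_nat (f := fun j => ‖z j‖) N).2 ht0)]
  refine ⟨‖p‖, norm_nonneg _, ‖p‖⁻¹ • p, ⟨fun j => z (j + N), 0, fun j => ⟨hz _, hzn j⟩,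
    fun j _ => by simp, ?_⟩, ?_⟩
  · have h1 : Tendsto (fun j => ‖(s j)⁻¹ • z j‖⁻¹ • ((s j)⁻¹ • z j)) atTop (nhds (‖p‖⁻¹ • p)) :=
      (hp.norm.inv₀ (norm_ne_zero_iff.2 hp0)).smul hp
    refine ((tendsto_add_atTop_iff_nat N).2 h1).congr fun j => ?_
    rw [sub_zero, norm_smul, norm_inv, Real.norm_of_nonneg (hs _).le, smul_smul, mul_inv, inv_inv]
    congr 1
    have := (hs (j + N)).ne'
    field_simp
  · rw [smul_smul, mul_inv_cancel₀ (norm_ne_zero_iff.2 hp0), one_smul]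

lemma aux_seq {E : Type*} [NormedAddCommGroup E] [NormedSpace ℝ E] (X : Set E)
    (t : ℕ → ℝ) (ht : ∀ j, 0 < t j) (v : E) (hv : v ∈ coneOver (dirSeqAt X 0 t))
    (hv1 : ‖v‖ = 1) :
    ∃ x : ℕ → E, (∀ j, x j ∈ X) ∧ Tendsto (fun j => (t j)⁻¹ • x j) atTop (nhds v) := by
  obtain ⟨r, hr, u, ⟨x, j₀, hx, hxt, hlim⟩, rfl⟩ := hv
  simp only [sub_zero] at hxt hlim
  have hu : ‖u‖ = 1 := by
    refine tendsto_nhds_unique hlim.norm (tendsto_const_nhds.congr' ?_)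
    filter_upwards [eventually_ge_atTop j₀] with j hj
    rw [norm_smul, norm_inv, Real.norm_of_nonneg (ht j).le, hxt j hj, inv_mul_cancel₀ (ht j).ne']
  rw [norm_smul, hu, mul_one, Real.norm_of_nonneg hr] at hv1
  subst hv1
  exact ⟨x, fun j => (hx j).1, by simpa using hlim⟩

/-- if `X ∋ 0` has the unique tangent cone `T` at `0` and `X` is Lipschitz
normally embedded with constant `lam`, then for unit vectors `v, w ∈ T` one has
`d_T(v, w) ≤ lam * ‖v - w‖`. -/
theorem stmt5 {m : ℕ} (X : Set (EuclideanSpace ℝ (Fin m))) (h0 : 0 ∈ X)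
    (T : Set (EuclideanSpace ℝ (Fin m)))
    (hT : ∀ t : ℕ → ℝ, (∀ j, 0 < t j) → Filter.Tendsto t Filter.atTop (nhds 0) →
      coneOver (dirSeqAt X 0 t) = T)
    (lam : ℝ) (hlam : 1 ≤ lam)
    (hne : ∀ x ∈ X, ∀ y ∈ X, innerDist X x y ≤ ENNReal.ofReal (lam * ‖x - y‖))
    (v w : EuclideanSpace ℝ (Fin m)) (hv : v ∈ T) (hw : w ∈ T)
    (hv1 : ‖v‖ = 1) (hw1 : ‖w‖ = 1) :
    innerDist T v w ≤ ENNReal.ofReal (lam * ‖v - w‖) := by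
  classical
  set t : ℕ → ℝ := fun j => 1 / ((j:ℝ) + 1) with ht_def
  have ht : ∀ j, 0 < t j := fun j => by simp only [ht_def]; positivity
  have ht0 : Tendsto t atTop (nhds 0) := tendsto_one_div_add_atTop_nhds_zero_nat
  have hTt := hT t ht ht0
  obtain ⟨x, hxX, hx⟩ := aux_seq X t ht v (hTt ▸ hv) hv1
  obtain ⟨y, hyX, hy⟩ := aux_seq X t ht w (hTt ▸ hw) hw1
  have h0T : (0 : EuclideanSpace ℝ (Fin m)) ∈ T := by
    rw [← hTt] at hv ⊢
    obtain ⟨r, hr, u, hu, -⟩ := hv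
    exact ⟨0, le_rfl, u, hu, by simp⟩
  have hlam0 : 0 ≤ lam := by linarith
  have hex : ∀ j, ∃ β : ℝ → EuclideanSpace ℝ (Fin m), β 0 = x j ∧ β 1 = y j ∧
      (∀ s ∈ Icc (0:ℝ) 1, β s ∈ X) ∧ ∀ a b, 0 ≤ a → a ≤ b → b ≤ 1 →
        dist (β a) (β b) ≤ (lam * ‖x j - y j‖ + t j * t j) * (b - a) := by
    intro j
    have hpos : 0 < lam * ‖x j - y j‖ + t j * t j := by have := ht j; positivity
    have h1 : innerDist X (x j) (y j) < ENNReal.ofReal (lam * ‖x j - y j‖ + t j * t j) :=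
      (hne _ (hxX j) _ (hyX j)).trans_lt ((ENNReal.ofReal_lt_ofReal_iff hpos).2
        (by have := mul_pos (ht j) (ht j); linarith))
    unfold innerDist at h1
    simp only [iInf_lt_iff] at h1
    obtain ⟨γ, hγ, hl⟩ := h1
    exact aux_reparam X _ _ γ hγ _ hpos.le hl.le
  choose β hβ0 hβ1 hβX hβL using hex
  set L : ℕ → ℝ := fun j => lam * ‖(t j)⁻¹ • x j - (t j)⁻¹ • y j‖ + t j with hL
  have hLlim : Tendsto L atTop (nhds (lam * ‖v - w‖)) := by
    simpa using ((hx.sub hy).norm.const_mul lam).add ht0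
  set α : ℕ → ℝ → EuclideanSpace ℝ (Fin m) := fun j s => (t j)⁻¹ • β j s with hα
  have hαL : ∀ j a b, 0 ≤ a → a ≤ b → b ≤ 1 → dist (α j a) (α j b) ≤ L j * (b - a) := by
    intro j a b ha hab hb
    have h := hβL j a b ha hab hb
    have htj := ht j
    simp only [hα, hL]
    rw [dist_smul₀, ← smul_sub, norm_smul, norm_inv, Real.norm_of_nonneg htj.le]
    calc (t j)⁻¹ * dist (β j a) (β j b)
        ≤ (t j)⁻¹ * ((lam * ‖x j - y j‖ + t j * t j) * (b - a)) := by gcongr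
      _ = _ := by field_simp
  obtain ⟨C, hC⟩ := hLlim.bddAbove_range
  obtain ⟨D, hD⟩ := hx.norm.bddAbove_range
  have hbd : ∀ j, ∀ s ∈ Icc (0:ℝ) 1, α j s ∈ closedBall (0 : EuclideanSpace ℝ (Fin m)) (C + D) := by
    intro j s hs
    have h1 := hαL j 0 s le_rfl hs.1 hs.2
    have h2 : L j ≤ C := hC ⟨j, rfl⟩
    have h3 : ‖(t j)⁻¹ • x j‖ ≤ D := hD ⟨j, rfl⟩
    have h4 : α j 0 = (t j)⁻¹ • x j := by simp only [hα, hβ0]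
    have h5 : 0 ≤ L j := by have := ht j; simp only [hL]; positivity
    rw [mem_closedBall]
    have h6 := dist_triangle_left (α j s) 0 (α j 0)
    rw [h4, dist_zero_right ((t j)⁻¹ • x j)] at h6
    rw [h4] at h1
    have h7 : L j * (s - 0) ≤ L j * 1 := mul_le_mul_of_nonneg_left (by linarith [hs.2]) h5
    linarith
  have hlim : ∀ s, ∃ p, s ∈ Icc (0:ℝ) 1 →
      Tendsto (fun j => α j s) (hyperfilter ℕ : Filter ℕ) (nhds p) := by
    intro s
    by_cases hs : s ∈ Icc (0:ℝ) 1
    · obtain ⟨p, -, hp⟩ := (isCompact_closedBall (0 : EuclideanSpace ℝ (Fin m)) (C + D)).ultrafilter_le_nhds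
        ((hyperfilter ℕ).map fun j => α j s) (by
          rw [le_principal_iff]
          exact Filter.mem_map.2 (Filter.Eventually.of_forall fun j => hbd j s hs))
      exact ⟨p, fun _ => hp⟩
    · exact ⟨0, fun h => absurd h hs⟩
  choose A hA using hlim
  have hyp : (hyperfilter ℕ : Filter ℕ) ≤ atTop := Nat.hyperfilter_le_atTop
  have hAL : ∀ a b, 0 ≤ a → a ≤ b → b ≤ 1 → dist (A a) (A b) ≤ lam * ‖v - w‖ * (b - a) := by
    intro a b ha hab hb
    exact le_of_tendsto_of_tendsto' ((hA a ⟨ha, hab.trans hb⟩).dist (hA b ⟨ha.trans hab, hb⟩))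
      ((hLlim.mono_left hyp).mul_const _) fun j => hαL j a b ha hab hb
  have hLip : LipschitzOnWith (Real.toNNReal (lam * ‖v - w‖)) A (Icc 0 1) := by
    refine LipschitzOnWith.of_dist_le_mul fun a ha b hb => ?_
    rw [Real.coe_toNNReal _ (by positivity)]
    rcases le_total a b with h | h
    · rw [dist_comm a b, Real.dist_eq, abs_of_nonneg (by linarith)]
      exact hAL a b ha.1 h hb.2
    · rw [dist_comm (A a), Real.dist_eq, abs_of_nonneg (by linarith)]
      exact hAL b a hb.1 h ha.2
  have hpath : IsPathIn T v w A := by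
    refine ⟨hLip.continuousOn, fun s hs => ?_, ?_, ?_⟩
    · have hcl : MapClusterPt (A s) atTop (fun j => α j s) :=
        (hA s hs).mapClusterPt.mono hyp
      obtain ⟨φ, hφ, hlimφ⟩ := MapClusterPt.tendsto_subseq hcl
      exact aux_mem X T hT h0T (t ∘ φ) (fun j => ht _) (ht0.comp hφ.tendsto_atTop)
        (fun j => β (φ j) s) (fun j => hβX _ s hs) _ hlimφ
    · refine tendsto_nhds_unique (hA 0 ⟨le_rfl, zero_le_one⟩) ?_
      simp only [hα, hβ0]
      exact hx.mono_left hyp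
    · refine tendsto_nhds_unique (hA 1 ⟨zero_le_one, le_rfl⟩) ?_
      simp only [hα, hβ1]
      exact hy.mono_left hyp
  refine (iInf₂_le A hpath).trans ?_
  have h := hLip.comp_eVariationOn_le (g := (id : ℝ → ℝ)) (s := Icc 0 1) (fun s hs => hs)
  have h2 : eVariationOn (id : ℝ → ℝ) (Icc 0 1) ≤ ENNReal.ofReal (1 - 0) := by
    have := (monotone_id (α := ℝ)).monotoneOn (Icc 0 1) |>.eVariationOn_le (a := 0) (b := 1)
      ⟨le_rfl, zero_le_one⟩ ⟨zero_le_one, le_rfl⟩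
    simpa using this
  calc pathLength A ≤ _ := h
    _ ≤ ENNReal.ofReal (lam * ‖v - w‖) * ENNReal.ofReal (1 - 0) := by
        exact mul_le_mul_right h2 _
    _ = _ := by simp
end

section
/- Local Lipschitz normal embedding is an open property for subanalytic germs admitting a finite Lipschitz stratification: if (X,0) ⊆ (ℝ^m,0) is Lipschitz normally embedded at 0 and X ∩ B_ε = ⊔_{i∈A} S_i is a Lipschitz stratification with A finite and the bilipschitz type of (X,y) constant along each stratum, then (X, y_i) is Lipschitz normally embedded for every stratum S_i and every y_i ∈ S_i. -/
open Set Filter Metric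

/-- `X` is Lipschitz normally embedded at `p`: on some open neighborhood `U` of `p`, the
inner metric of `X ∩ U` is bounded by a constant times the outer (Euclidean) metric. -/
def LNEat {E : Type*} [NormedAddCommGroup E] (X : Set E) (p : E) : Prop :=
  ∃ U : Set E, IsOpen U ∧ p ∈ U ∧ ∃ lam : ℝ, 1 ≤ lam ∧
    ∀ a ∈ X ∩ U, ∀ b ∈ X ∩ U, innerDist (X ∩ U) a b ≤ ENNReal.ofReal (lam * ‖a - b‖)

/-- The germs `(X, y)` and `(X, y')` are bilipschitz equivalent: there are open
neighborhoods and a bilipschitz bijection between the corresponding pieces of `X`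
sending `y` to `y'`. -/
def GermBilipschitzEquiv {E : Type*} [NormedAddCommGroup E] (X : Set E) (y y' : E) : Prop :=
  ∃ V V' : Set E, IsOpen V ∧ IsOpen V' ∧ y ∈ V ∧ y' ∈ V' ∧
    ∃ f : E → E, f y = y' ∧ Set.BijOn f (X ∩ V) (X ∩ V') ∧
      ∃ K : ℝ, 1 ≤ K ∧ ∀ a ∈ X ∩ V, ∀ b ∈ X ∩ V,
        ‖f a - f b‖ ≤ K * ‖a - b‖ ∧ ‖a - b‖ ≤ K * ‖f a - f b‖


/-! ### Discrete part -/

/-- `Conn adj Z n x y`: `x` and `y` are joined by a chain of at most `n` steps in `Z`. -/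
inductive Conn {α : Type*} (adj : α → α → Prop) (Z : Set α) : ℕ → α → α → Prop
  | refl (n : ℕ) (x : α) (hx : x ∈ Z) : Conn adj Z n x x
  | step (n : ℕ) (x y z : α) (h : Conn adj Z n x y) (ha : adj y z) (hz : z ∈ Z) :
      Conn adj Z (n + 1) x z

namespace Conn

variable {α : Type*} {adj : α → α → Prop} {Z Z' : Set α} {n n' : ℕ} {x y z : α}

theorem mono (hZ : Z ⊆ Z') (h : Conn adj Z n x y) : Conn adj Z' n x y := by
  induction h with
  | refl n x hx => exact Conn.refl _ _ (hZ hx)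
  | step n x y z h ha hz ih => exact Conn.step _ _ _ _ ih ha (hZ hz)

theorem left_mem (h : Conn adj Z n x y) : x ∈ Z := by
  induction h with
  | refl n x hx => exact hx
  | step n x y z h ha hz ih => exact ih

theorem right_mem (h : Conn adj Z n x y) : y ∈ Z := by
  cases h with
  | refl => assumption
  | step => assumption

theorem le (h : Conn adj Z n x y) (hn : n ≤ n') : Conn adj Z n' x y := by
  induction h generalizing n' with
  | refl n x hx => exact Conn.refl _ _ hx
  | step n x y z h ha hz ih =>
    obtain ⟨k, rfl⟩ : ∃ k, n' = k + 1 := ⟨n' - 1, by omega⟩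
    exact Conn.step _ _ _ _ (ih (by omega)) ha hz

theorem trans (h : Conn adj Z n x y) (h' : Conn adj Z n' y z) : Conn adj Z (n + n') x z := by
  induction h' with
  | refl m w hw => exact h.le (by omega)
  | step m w u v h1 ha hz ih => exact Conn.step _ _ _ _ (ih h) ha hz

theorem symm (hs : ∀ a b, adj a b → adj b a) (h : Conn adj Z n x y) : Conn adj Z n y x := by
  induction h with
  | refl n x hx => exact Conn.refl _ _ hx
  | step n x y z h ha hz ih =>
    have h1 : Conn adj Z (0 + 1) z y :=
      Conn.step _ _ _ _ (Conn.refl 0 z hz) (hs _ _ ha) ih.left_mem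
    exact (h1.trans ih).le (by omega)

theorem exists_support (h : Conn adj Z n x y) :
    ∃ T : Set α, T ⊆ Z ∧ x ∈ T ∧ ∀ w ∈ T, Conn adj T n x w ∧ Conn adj T n w y := by
  have : ∃ T : Set α, T ⊆ Z ∧ x ∈ T ∧ y ∈ T ∧ ∀ w ∈ T, Conn adj T n x w ∧ Conn adj T n w y := by
    induction h with
    | refl n x hx =>
      refine ⟨{x}, by simpa using hx, rfl, rfl, ?_⟩
      rintro w rfl
      exact ⟨Conn.refl _ _ rfl, Conn.refl _ _ rfl⟩
    | step n x y z h ha hz ih =>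
      obtain ⟨T, hT, hx, hy, hw⟩ := ih
      have hsub : T ⊆ insert z T := Set.subset_insert _ _
      refine ⟨insert z T, Set.insert_subset hz hT, hsub hx, Set.mem_insert _ _, ?_⟩
      rintro w (rfl | hwT)
      · exact ⟨Conn.step _ _ _ _ ((hw y hy).1.mono hsub) ha (Set.mem_insert _ _),
          Conn.refl _ _ (Set.mem_insert _ _)⟩
      · exact ⟨((hw w hwT).1.mono hsub).le (by omega),
          Conn.step _ _ _ _ ((hw w hwT).2.mono hsub) ha (Set.mem_insert _ _)⟩
  obtain ⟨T, h1, h3, -, h2⟩ := this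
  exact ⟨T, h1, h3, h2⟩

end Conn

/-- The increasing sequence of sets obtained by joining the badly connected close pairs. -/
def growSeq {α : Type*} (adj close : α → α → Prop) (T : α → α → Set α) (L : ℕ) (A : Set α) :
    ℕ → Set α
  | 0 => A
  | n + 1 => growSeq adj close T L A n ∪
      {x | ∃ p ∈ growSeq adj close T L A n, ∃ q ∈ growSeq adj close T L A n,
        close p q ∧ ¬ Conn adj (growSeq adj close T L A n) L p q ∧ x ∈ T p q}

theorem exists_grow {α : Type*} (adj close : α → α → Prop) (hs : ∀ a b, adj a b → adj b a)
    (k H : ℕ) (hk : ∀ p q, close p q → Conn adj Set.univ k p q)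
    (hcount : ∀ x, ∀ F : Finset α, (∀ y ∈ F, Conn adj Set.univ (k * H) x y) → F.card < 2 ^ H)
    (A : Set α) :
    ∃ Z : Set α, A ⊆ Z ∧ (∀ z ∈ Z, ∃ a ∈ A, Conn adj Z (k * H) z a) ∧
      ∀ p ∈ Z, ∀ q ∈ Z, close p q → Conn adj Z (2 * (k * H) + k) p q := by
  classical
  have hT : ∀ p q, ∃ T : Set α, close p q → p ∈ T ∧ ∀ w ∈ T, Conn adj T k p w ∧ Conn adj T k w q := by
    intro p q
    by_cases h : close p q
    · obtain ⟨T, -, h2⟩ := (hk p q h).exists_support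
      exact ⟨T, fun _ => h2⟩
    · exact ⟨∅, fun h' => absurd h' h⟩
  choose T hT using hT
  set L := 2 * (k * H) + k with hL
  set G := growSeq adj close T L A with hG
  have hG0 : G 0 = A := rfl
  have hGs : ∀ n, G (n + 1) = G n ∪ {x | ∃ p ∈ G n, ∃ q ∈ G n,
        close p q ∧ ¬ Conn adj (G n) L p q ∧ x ∈ T p q} := fun n => rfl
  have hmono : Monotone G := monotone_nat_of_le_succ fun n => by
    rw [hGs]; exact Set.subset_union_left
  have hTG : ∀ n, ∀ p ∈ G n, ∀ q ∈ G n, close p q → ¬ Conn adj (G n) L p q →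
      T p q ⊆ G (n + 1) := by
    intro n p hp q hq hc hb x hx
    rw [hGs]
    exact Or.inr ⟨p, hp, q, hq, hc, hb, hx⟩
  have key : ∀ h ≤ H, ∀ n, ∀ x ∈ G n, (∃ a ∈ A, Conn adj (G n) (k * h) x a) ∨
      ∃ F : Finset α, F.card = 2 ^ h ∧ ∀ y ∈ F, Conn adj (G n) (k * h) x y := by
    intro h
    induction h with
    | zero =>
      intro _ n x hx
      refine Or.inr ⟨{x}, by simp, ?_⟩
      intro y hy
      rw [Finset.mem_singleton] at hy
      subst hy
      exact Conn.refl _ _ hx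
    | succ h ihh =>
      intro hH n
      induction n with
      | zero =>
        intro x hx
        exact Or.inl ⟨x, hx, Conn.refl _ _ hx⟩
      | succ n ihn =>
        intro x hx
        have hsub : G n ⊆ G (n + 1) := hmono (Nat.le_succ n)
        rw [hGs] at hx
        rcases hx with hx | ⟨p, hp, q, hq, hc, hb, hx⟩
        · rcases ihn x hx with ⟨a, ha, h1⟩ | ⟨F, hF, h1⟩
          · exact Or.inl ⟨a, ha, h1.mono hsub⟩
          · exact Or.inr ⟨F, hF, fun y hy => (h1 y hy).mono hsub⟩
        · have hxp : Conn adj (G (n + 1)) k x p :=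
            (((hT p q hc).2 x hx).1.mono (hTG n p hp q hq hc hb)).symm hs
          have hxq : Conn adj (G (n + 1)) k x q :=
            ((hT p q hc).2 x hx).2.mono (hTG n p hp q hq hc hb)
          have hkk : k * (h + 1) = k + k * h := by ring
          rw [hkk]
          rcases ihh (by omega) n p hp with ⟨a, ha, h1⟩ | ⟨F, hF, h1⟩
          · exact Or.inl ⟨a, ha, hxp.trans (h1.mono hsub)⟩
          rcases ihh (by omega) n q hq with ⟨a, ha, h2⟩ | ⟨F', hF', h2⟩
          · exact Or.inl ⟨a, ha, hxq.trans (h2.mono hsub)⟩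
          refine Or.inr ⟨F ∪ F', ?_, ?_⟩
          · rw [Finset.card_union_of_disjoint, hF, hF', pow_succ]; · ring
            rw [Finset.disjoint_left]
            intro y hy hy'
            apply hb
            refine ((h1 y hy).trans ((h2 y hy').symm hs)).le ?_
            have : k * h ≤ k * H := Nat.mul_le_mul_left _ (by omega)
            omega
          · intro y hy
            rcases Finset.mem_union.1 hy with hy | hy
            · exact hxp.trans ((h1 y hy).mono hsub)
            · exact hxq.trans ((h2 y hy).mono hsub)
  refine ⟨⋃ n, G n, fun a ha => Set.mem_iUnion.2 ⟨0, ha⟩, ?_, ?_⟩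
  · intro z hz
    obtain ⟨n, hn⟩ := Set.mem_iUnion.1 hz
    rcases key H le_rfl n z hn with ⟨a, ha, h1⟩ | ⟨F, hF, h1⟩
    · exact ⟨a, ha, h1.mono (Set.subset_iUnion G n)⟩
    · exact absurd hF (hcount z F fun y hy => (h1 y hy).mono (Set.subset_univ _)).ne
  · intro p hp q hq hc
    obtain ⟨n, hn⟩ := Set.mem_iUnion.1 hp
    obtain ⟨n', hn'⟩ := Set.mem_iUnion.1 hq
    have hp' : p ∈ G (max n n') := hmono (le_max_left _ _) hn
    have hq' : q ∈ G (max n n') := hmono (le_max_right _ _) hn'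
    by_cases hb : Conn adj (G (max n n')) L p q
    · exact hb.mono (Set.subset_iUnion G _)
    · have h1 := ((hT p q hc).2 p (hT p q hc).1).2
      exact ((h1.mono (hTG _ p hp' q hq' hc hb)).mono (Set.subset_iUnion G _)).le (by omega)

/-! ### Paths -/

/-- `a` and `b` are joined by a path in `Y` of length at most `l`. -/
def Joined' {E : Type*} [NormedAddCommGroup E] (Y : Set E) (a b : E) (l : ℝ) : Prop :=
  ∃ γ : ℝ → E, IsPathIn Y a b γ ∧ pathLength γ ≤ ENNReal.ofReal l

namespace Joined'

variable {E : Type*} [NormedAddCommGroup E] {Y Y' : Set E} {a b c : E} {l l' : ℝ}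

theorem mono (hY : Y ⊆ Y') (h : Joined' Y a b l) : Joined' Y' a b l := by
  obtain ⟨γ, ⟨h1, h2, h3, h4⟩, h5⟩ := h
  exact ⟨γ, ⟨h1, h2.mono_right hY, h3, h4⟩, h5⟩

theorem le (h : Joined' Y a b l) (hl : l ≤ l') : Joined' Y a b l' := by
  obtain ⟨γ, h1, h5⟩ := h
  exact ⟨γ, h1, h5.trans (ENNReal.ofReal_le_ofReal hl)⟩

theorem refl (ha : a ∈ Y) (l : ℝ) : Joined' Y a a l := by
  refine ⟨fun _ => a, ⟨continuousOn_const, fun _ _ => ha, rfl, rfl⟩, ?_⟩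
  have : pathLength (fun _ : ℝ => a) = 0 := by
    apply eVariationOn.constant_on
    rintro _ ⟨_, _, rfl⟩ _ ⟨_, _, rfl⟩
    rfl
  rw [this]; exact zero_le

theorem symm (h : Joined' Y a b l) : Joined' Y b a l := by
  obtain ⟨γ, ⟨h1, h2, h3, h4⟩, h5⟩ := h
  have hm : MapsTo (fun t : ℝ => 1 - t) (Icc 0 1) (Icc 0 1) := by
    intro t ht
    simp only [mem_Icc] at ht ⊢
    constructor <;> linarith [ht.1, ht.2]
  refine ⟨γ ∘ (fun t => 1 - t), ⟨h1.comp (by fun_prop) hm, h2.comp hm, by simp [h4], by simp [h3]⟩, ?_⟩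
  refine le_trans ?_ h5
  apply eVariationOn.comp_le_of_antitoneOn _ _ _ hm
  intro x _ y _ hxy
  dsimp only
  linarith

theorem left_mem (h : Joined' Y a b l) : a ∈ Y := by
  obtain ⟨γ, ⟨h1, h2, h3, h4⟩, h5⟩ := h
  exact h3 ▸ h2 (by simp)

theorem right_mem (h : Joined' Y a b l) : b ∈ Y := h.symm.left_mem

theorem trans (hl : 0 ≤ l) (hl' : 0 ≤ l') (h : Joined' Y a b l) (h' : Joined' Y b c l') :
    Joined' Y a c (l + l') := by
  obtain ⟨γ, ⟨h1, h2, h3, h4⟩, h5⟩ := h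
  obtain ⟨δ, ⟨g1, g2, g3, g4⟩, g5⟩ := h'
  have m1 : MapsTo (fun t : ℝ => 2 * t) (Icc 0 (1/2)) (Icc 0 1) := by
    intro t ht
    simp only [mem_Icc] at ht ⊢
    constructor <;> linarith [ht.1, ht.2]
  have m2 : MapsTo (fun t : ℝ => 2 * t - 1) (Icc (1/2) 1) (Icc 0 1) := by
    intro t ht
    simp only [mem_Icc] at ht ⊢
    constructor <;> linarith [ht.1, ht.2]
  set η : ℝ → E := fun t => if t ≤ 1/2 then γ (2 * t) else δ (2 * t - 1) with hη
  have e1 : EqOn η (γ ∘ fun t => 2 * t) (Icc 0 (1/2)) := by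
    intro t ht
    simp only [hη, Function.comp, if_pos ht.2]
  have e2 : EqOn η (δ ∘ fun t => 2 * t - 1) (Icc (1/2) 1) := by
    intro t ht
    by_cases h : t ≤ 1/2
    · have : t = 1/2 := le_antisymm h ht.1
      subst this
      simp only [hη, Function.comp, le_refl, if_true]
      norm_num [g3, h4]
    · simp only [hη, Function.comp, if_neg h]
  have hI : Icc (0:ℝ) 1 = Icc 0 (1/2) ∪ Icc (1/2) 1 :=
    (Icc_union_Icc_eq_Icc (by norm_num) (by norm_num)).symm
  have c1 : ContinuousOn η (Icc 0 (1/2)) := (h1.comp (by fun_prop) m1).congr e1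
  have c2 : ContinuousOn η (Icc (1/2) 1) := (g1.comp (by fun_prop) m2).congr e2
  refine ⟨η, ⟨?_, ?_, ?_, ?_⟩, ?_⟩
  · rw [hI]
    exact c1.union_of_isClosed c2 isClosed_Icc isClosed_Icc
  · rw [hI]
    rintro t (ht | ht)
    · rw [e1 ht]; exact h2 (m1 ht)
    · rw [e2 ht]; exact g2 (m2 ht)
  · rw [e1 (by norm_num)]; simp [h3]
  · rw [e2 (by norm_num)]; norm_num [g4]
  · unfold pathLength
    rw [hI, eVariationOn.union η (x := 1/2) (isGreatest_Icc (by norm_num))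
      (isLeast_Icc (by norm_num)), ENNReal.ofReal_add hl hl', eVariationOn.congr e1,
      eVariationOn.congr e2]
    refine add_le_add (le_trans ?_ h5) (le_trans ?_ g5)
    · apply eVariationOn.comp_le_of_monotoneOn _ _ _ m1
      intro x _ y _ hxy
      dsimp only
      linarith
    · apply eVariationOn.comp_le_of_monotoneOn _ _ _ m2
      intro x _ y _ hxy
      dsimp only
      linarith

/-- A path of length at most `l` consists of points joined to its start. -/
theorem restrict (h : Joined' Y a b l) :
    Joined' {x | Joined' Y a x l} a b l := by
  obtain ⟨γ, ⟨h1, h2, h3, h4⟩, h5⟩ := h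
  refine ⟨γ, ⟨h1, ?_, h3, h4⟩, h5⟩
  intro s hs
  have hm : MapsTo (fun t : ℝ => s * t) (Icc 0 1) (Icc 0 1) := by
    intro t ht
    simp only [mem_Icc] at ht hs ⊢
    exact ⟨mul_nonneg hs.1 ht.1, mul_le_one₀ hs.2 ht.1 ht.2⟩
  refine ⟨γ ∘ fun t => s * t, ⟨h1.comp (by fun_prop) hm, h2.comp hm, by simp [h3], by simp⟩, ?_⟩
  refine le_trans ?_ h5
  apply eVariationOn.comp_le_of_monotoneOn _ _ _ hm
  intro x _ y _ hxy
  exact mul_le_mul_of_nonneg_left hxy hs.1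

theorem norm_le (hl : 0 ≤ l) (h : Joined' Y a b l) : ‖a - b‖ ≤ l := by
  obtain ⟨γ, ⟨h1, h2, h3, h4⟩, h5⟩ := h
  have := (eVariationOn.edist_le γ (s := Icc (0:ℝ) 1) (x := 0) (y := 1) (by simp) (by simp)).trans h5
  rw [h3, h4, edist_dist, ENNReal.ofReal_le_ofReal_iff hl, dist_eq_norm] at this
  exact this

theorem exists_chain {r : ℝ} (hr : 0 < r) (K : ℕ) (h : Joined' Y a b (K * r)) :
    Conn (fun u v => ‖u - v‖ ≤ r) Y (K + 1) a b := by
  obtain ⟨γ, ⟨h1, h2, h3, h4⟩, h5⟩ := h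
  have key : ∀ K : ℕ, ∀ s ∈ Icc (0:ℝ) 1, eVariationOn γ (Icc s 1) ≤ ENNReal.ofReal (K * r) →
      Conn (fun u v => ‖u - v‖ ≤ r) Y (K + 1) (γ s) (γ 1) := by
    intro K
    induction K with
    | zero =>
      intro s hs hv
      have h6 := (eVariationOn.edist_le γ (s := Icc s 1) (x := s) (y := 1) (by simp [hs.2])
        (by simp [hs.2])).trans hv
      refine Conn.step _ _ _ _ (Conn.refl _ _ (h2 hs)) ?_ (h2 (by simp))
      rw [edist_dist, ENNReal.ofReal_le_ofReal_iff (by positivity), dist_eq_norm] at h6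
      simp only [Nat.cast_zero, zero_mul] at h6
      exact h6.trans hr.le
    | succ K ih =>
      intro s hs hv
      by_cases hd : ‖γ s - γ 1‖ ≤ r
      · exact (Conn.step 0 _ _ _ (Conn.refl _ _ (h2 hs)) hd (h2 (by simp))).le (by omega)
      · push Not at hd
        have hc : ContinuousOn (fun t => ‖γ s - γ t‖) (Icc s 1) :=
          (continuousOn_const.sub (h1.mono (Icc_subset_Icc_left hs.1))).norm
        obtain ⟨t, ht, hts⟩ : r ∈ (fun t => ‖γ s - γ t‖) '' Icc s 1 := by
          apply intermediate_value_Icc hs.2 hc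
          simp only [sub_self, norm_zero, mem_Icc]
          exact ⟨hr.le, hd.le⟩
        dsimp only at hts
        have ht' : t ∈ Icc (0:ℝ) 1 := ⟨hs.1.trans ht.1, ht.2⟩
        have hsum := eVariationOn.union γ (s := Icc s t) (t := Icc t 1) (x := t)
          (isGreatest_Icc ht.1) (isLeast_Icc ht.2)
        rw [Icc_union_Icc_eq_Icc ht.1 ht.2] at hsum
        have hlow : ENNReal.ofReal r ≤ eVariationOn γ (Icc s t) := by
          have := eVariationOn.edist_le γ (s := Icc s t) (x := s) (y := t) (by simp [ht.1])
            (by simp [ht.1])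
          rwa [edist_dist, dist_eq_norm, hts] at this
        have hv' : eVariationOn γ (Icc t 1) ≤ ENNReal.ofReal (K * r) := by
          have h7 : ENNReal.ofReal r + eVariationOn γ (Icc t 1) ≤
              ENNReal.ofReal r + ENNReal.ofReal (K * r) := by
            rw [← ENNReal.ofReal_add hr.le (by positivity)]
            calc _ ≤ eVariationOn γ (Icc s t) + eVariationOn γ (Icc t 1) := by gcongr
              _ ≤ _ := by
                rw [← hsum]
                refine hv.trans (le_of_eq ?_)
                congr 1
                push_cast
                ring
          exact (ENNReal.add_le_add_iff_left ENNReal.ofReal_ne_top).1 h7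
        have h8 := ih t ht' hv'
        have h9 : Conn (fun u v => ‖u - v‖ ≤ r) Y (0 + 1) (γ s) (γ t) :=
          Conn.step 0 _ _ _ (Conn.refl _ _ (h2 hs)) hts.le (h2 ht')
        exact (h9.trans h8).le (by omega)
  have := key K 0 (by simp) h5
  rwa [h3, h4] at this

end Joined'

/-! ### Counting separated points -/

theorem card_le_of_sep {E : Type*} [NormedAddCommGroup E] [NormedSpace ℝ E]
    [FiniteDimensional ℝ E] (s : Finset E) (x : E) {r R : ℝ} (hr : 0 < r) (hR : 0 ≤ R)
    (hs : ∀ c ∈ s, ‖x - c‖ ≤ R * r) (h : ∀ c ∈ s, ∀ d ∈ s, c ≠ d → r ≤ ‖c - d‖) :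
    (s.card : ℝ) ≤ (2 * R + 1) ^ Module.finrank ℝ E := by
  borelize E
  let μ : MeasureTheory.Measure E := MeasureTheory.Measure.addHaar
  have hδ : 0 < r / 2 := by positivity
  have hρ : 0 < (2 * R + 1) * (r / 2) := by positivity
  set A := ⋃ c ∈ s, ball (c : E) (r / 2) with hA
  have D : Set.Pairwise (s : Set E) (Function.onFun Disjoint fun c => ball (c : E) (r / 2)) := by
    rintro c hc d hd hcd
    apply ball_disjoint_ball
    rw [dist_eq_norm]
    have := h c hc d hd hcd
    linarith
  have A_subset : A ⊆ ball x ((2 * R + 1) * (r / 2)) := by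
    refine iUnion₂_subset fun y hy => ?_
    apply ball_subset_ball'
    have := hs y hy
    rw [dist_comm, dist_eq_norm]
    linarith
  have I : (s.card : ENNReal) * ENNReal.ofReal ((r / 2) ^ Module.finrank ℝ E) * μ (ball 0 1) ≤
      ENNReal.ofReal (((2 * R + 1) * (r / 2)) ^ Module.finrank ℝ E) * μ (ball 0 1) :=
    calc
      (s.card : ENNReal) * ENNReal.ofReal ((r / 2) ^ Module.finrank ℝ E) * μ (ball 0 1) = μ A := by
        rw [hA, MeasureTheory.measure_biUnion_finset D fun c _ => measurableSet_ball]
        simp only [μ.addHaar_ball_of_pos _ hδ]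
        simp only [Finset.sum_const, nsmul_eq_mul, mul_assoc]
      _ ≤ μ (ball x ((2 * R + 1) * (r / 2))) := MeasureTheory.measure_mono A_subset
      _ = _ := by
        simp only [μ.addHaar_ball_of_pos _ hρ]
  have J : (s.card : ENNReal) * ENNReal.ofReal ((r / 2) ^ Module.finrank ℝ E) ≤
      ENNReal.ofReal (((2 * R + 1) * (r / 2)) ^ Module.finrank ℝ E) :=
    (ENNReal.mul_le_mul_iff_left (measure_ball_pos _ _ zero_lt_one).ne'
      MeasureTheory.measure_ball_lt_top.ne).1 I
  have K := ENNReal.toReal_le_of_le_ofReal (pow_nonneg hρ.le _) J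
  rw [ENNReal.toReal_mul, ENNReal.toReal_natCast, ENNReal.toReal_ofReal (by positivity),
    mul_pow] at K
  exact le_of_mul_le_mul_right K (by positivity)

theorem exists_H (m k : ℕ) : ∃ H : ℕ, (2 * (3 * ((k * H : ℕ) : ℝ)) + 1) ^ m < 2 ^ H := by
  have h := tendsto_pow_const_div_const_pow_of_one_lt m (r := (2 : ℝ)) (by norm_num)
  have hpos : (0 : ℝ) < ((6 * (k : ℝ) + 1) ^ m)⁻¹ := by positivity
  obtain ⟨H, hH, hH1⟩ := ((h.eventually (gt_mem_nhds hpos)).and (eventually_ge_atTop 1)).exists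
  refine ⟨H, ?_⟩
  have h1 : (1 : ℝ) ≤ H := by exact_mod_cast hH1
  rw [div_lt_iff₀ (by positivity), ← div_eq_inv_mul, lt_div_iff₀ (by positivity), ← mul_pow] at hH
  refine lt_of_le_of_lt ?_ hH
  refine pow_le_pow_left₀ (by positivity) ?_ _
  push_cast
  nlinarith

theorem exists_net {E : Type*} [NormedAddCommGroup E] (Y : Set E) {r : ℝ} (hr : 0 < r) :
    ∃ P : Set E, P ⊆ Y ∧ (∀ p ∈ P, ∀ q ∈ P, p ≠ q → r ≤ ‖p - q‖) ∧
      ∀ y ∈ Y, ∃ p ∈ P, ‖y - p‖ < r := by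
  obtain ⟨P, hP⟩ := zorn_subset {P : Set E | P ⊆ Y ∧ P.Pairwise fun p q => r ≤ ‖p - q‖} (by
    intro c hc hch
    refine ⟨⋃₀ c, ⟨sUnion_subset fun s hs => (hc hs).1, ?_⟩, fun s hs => subset_sUnion_of_mem hs⟩
    rw [pairwise_sUnion hch.directedOn]
    exact fun s hs => (hc hs).2)
  refine ⟨P, hP.prop.1, fun p hp q hq h => hP.prop.2 hp hq h, ?_⟩
  intro y hy
  by_contra! hcon
  have hmem : insert y P ∈ {P : Set E | P ⊆ Y ∧ P.Pairwise fun p q => r ≤ ‖p - q‖} := by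
    refine ⟨insert_subset hy hP.prop.1, hP.prop.2.insert fun b hb _ => ⟨hcon b hb, ?_⟩⟩
    rw [norm_sub_rev]
    exact hcon b hb
  have hyP : y ∈ P := hP.le_of_ge hmem (subset_insert _ _) (mem_insert _ _)
  have := hcon y hyP
  simp only [sub_self, norm_zero] at this
  linarith

/-! ### One step of the construction -/

theorem exists_step {E : Type*} [NormedAddCommGroup E] [NormedSpace ℝ E]
    [FiniteDimensional ℝ E] (Y : Set E) (Λ : ℝ) (hΛ : 1 ≤ Λ)
    (hY : ∀ a ∈ Y, ∀ b ∈ Y, Joined' Y a b (Λ * ‖a - b‖)) :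
    ∃ C D : ℝ, 1 ≤ C ∧ 1 ≤ D ∧ ∀ r > 0, ∀ W ⊆ Y, ∃ W' ⊆ Y,
      (∀ w ∈ W, ∀ x ∈ Y, ‖x - w‖ ≤ r → x ∈ W') ∧
      (∀ x ∈ W', ∃ w ∈ W, Joined' W' x w (C * r)) ∧
      (∀ a ∈ W', ∀ b ∈ W', ‖a - b‖ ≤ 2 * r → Joined' W' a b (D * r)) := by
  classical
  set C₁ : ℝ := 6 * Λ + 2 with hC₁
  set K : ℕ := ⌈Λ * C₁⌉₊ with hK
  obtain ⟨H, hH⟩ := exists_H (Module.finrank ℝ E) (K + 1)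
  set k := K + 1 with hk
  set L := 2 * (k * H) + k with hL
  refine ⟨3 * Λ * ((k * H : ℕ) + 2), 3 * Λ * ((L : ℝ) + 2), ?_, ?_, ?_⟩
  · have : (0 : ℝ) ≤ (k * H : ℕ) := Nat.cast_nonneg _
    nlinarith
  · have : (0 : ℝ) ≤ L := Nat.cast_nonneg _
    nlinarith
  intro r hr W hW
  obtain ⟨P, hPY, hsep, hcov⟩ := exists_net Y hr
  set adj : P → P → Prop := fun u v => ‖(u : E) - v‖ ≤ 3 * r with hadj
  set close : P → P → Prop := fun u v => ‖(u : E) - v‖ ≤ C₁ * r with hclose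
  have hsymm : ∀ a b, adj a b → adj b a := by
    intro a b h
    simp only [hadj] at h ⊢
    rwa [norm_sub_rev]
  have hchain : ∀ p q, close p q → Conn adj Set.univ k p q := by
    intro p q hc
    have hj : Joined' Y (p : E) q (K * r) := by
      refine (hY p (hPY p.2) q (hPY q.2)).le ?_
      have h1 : Λ * C₁ ≤ K := Nat.le_ceil _
      calc Λ * ‖(p : E) - q‖ ≤ Λ * (C₁ * r) := by gcongr
        _ = (Λ * C₁) * r := by ring
        _ ≤ K * r := by gcongr
    have hcn := hj.exists_chain hr K
    have hπ : ∀ x : E, ∃ p' : P, x ∈ Y → ‖x - p'‖ < r := by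
      intro x
      by_cases hx : x ∈ Y
      · obtain ⟨p', hp', h⟩ := hcov x hx
        exact ⟨⟨p', hp'⟩, fun _ => h⟩
      · exact ⟨p, fun h => absurd h hx⟩
    choose π hπ using hπ
    have hπP : ∀ u : P, π u = u := by
      intro u
      by_contra hne
      have h1 := hπ u (hPY u.2)
      have h2 := hsep (u : E) u.2 (π u) (π u).2 (fun h => hne (Subtype.ext h.symm))
      linarith
    have hround : ∀ n a b, Conn (fun u v : E => ‖u - v‖ ≤ r) Y n a b →
        Conn adj Set.univ n (π a) (π b) := by
      intro n a b h
      induction h with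
      | refl n x hx => exact Conn.refl _ _ (mem_univ _)
      | step n x y z h ha hz ih =>
        refine Conn.step _ _ _ _ ih ?_ (mem_univ _)
        have h1 := hπ y h.right_mem
        have h2 := hπ z hz
        simp only [hadj]
        have : ((π y : E) - π z) = -(y - π y) + (y - z) + (z - π z) := by abel
        rw [this]
        refine (norm_add₃_le).trans ?_
        rw [norm_neg]
        linarith
    have := hround _ _ _ hcn
    rwa [hπP, hπP] at this
  have hdist : ∀ n x y, Conn adj Set.univ n x y → ‖(x : E) - y‖ ≤ 3 * (n : ℝ) * r := by
    intro n x y h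
    induction h with
    | refl n x hx => simp only [sub_self, norm_zero]; positivity
    | step n x y z h ha hz ih =>
      have h1 := norm_sub_le_norm_sub_add_norm_sub (x : E) y z
      simp only [hadj] at ha
      push_cast
      linarith
  have hcount : ∀ x, ∀ F : Finset P, (∀ y ∈ F, Conn adj Set.univ (k * H) x y) →
      F.card < 2 ^ H := by
    intro x F hF
    have h1 := card_le_of_sep (F.map (Function.Embedding.subtype _)) (x : E) hr
      (R := 3 * ((k * H : ℕ) : ℝ)) (by positivity) (by
        intro c hc
        obtain ⟨y, hy, rfl⟩ := Finset.mem_map.1 hc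
        exact hdist _ _ _ (hF y hy)) (by
        intro c hc d hd hcd
        obtain ⟨y, hy, rfl⟩ := Finset.mem_map.1 hc
        obtain ⟨z, hz, rfl⟩ := Finset.mem_map.1 hd
        exact hsep _ y.2 _ z.2 hcd)
    rw [Finset.card_map] at h1
    exact_mod_cast h1.trans_lt hH
  obtain ⟨Z, hAZ, hZA, hZZ⟩ := exists_grow adj close hsymm k H hchain hcount
    {p : P | ∃ w ∈ W, ‖w - p‖ ≤ r}
  set W' : Set E := {x | ∃ z ∈ Z, Joined' Y (z : E) x (3 * Λ * r)} with hW'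
  have hstep : ∀ z ∈ Z, ∀ x, Joined' Y (z : E) x (3 * Λ * r) → Joined' W' (z : E) x (3 * Λ * r) :=
    fun z hz x h => Joined'.mono (fun y (hy : Joined' Y (z : E) y (3 * Λ * r)) =>
      (⟨z, hz, hy⟩ : ∃ z ∈ Z, Joined' Y (z : E) y (3 * Λ * r))) h.restrict
  have hedge : ∀ z ∈ Z, ∀ x ∈ Y, ‖(z : E) - x‖ ≤ 3 * r → Joined' W' (z : E) x (3 * Λ * r) := by
    intro z hz x hx h
    refine hstep z hz x ((hY z (hPY z.2) x hx).le ?_)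
    nlinarith
  have hpos : 0 ≤ 3 * Λ * r := by positivity
  have hconn : ∀ n z z', Conn adj Z n z z' → Joined' W' (z : E) z' (n * (3 * Λ * r)) := by
    intro n z z' h
    induction h with
    | refl n x hx =>
      have hxW : (x : E) ∈ W' := ⟨x, hx, Joined'.refl (hPY x.2) _⟩
      exact Joined'.refl hxW _
    | step n x y z h ha hz ih =>
      refine (Joined'.trans (by positivity) hpos ih (hedge y h.right_mem z (hPY z.2) ha)).le ?_
      push_cast
      linarith
  refine ⟨W', ?_, ?_, ?_, ?_⟩
  · rintro x ⟨z, _, h⟩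
    exact h.right_mem
  · intro w hw x hx hxw
    obtain ⟨p, hp, hpw⟩ := hcov w (hW hw)
    refine (hedge ⟨p, hp⟩ (hAZ ⟨w, hw, hpw.le⟩) x hx ?_).right_mem
    have h1 := norm_sub_le_norm_sub_add_norm_sub p w x
    rw [norm_sub_rev p w, norm_sub_rev w x] at h1
    dsimp only
    linarith
  · rintro x ⟨z, hz, hzx⟩
    obtain ⟨p, ⟨w, hw, hwp⟩, hc⟩ := hZA z hz
    refine ⟨w, hw, ?_⟩
    have j1 := (hstep z hz x hzx).symm
    have j2 := hconn _ _ _ hc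
    have j3 := hedge p hc.right_mem w (hW hw) (by rw [norm_sub_rev]; linarith)
    refine (Joined'.trans (by positivity) hpos (Joined'.trans hpos (by positivity) j1 j2) j3).le ?_
    linarith
  · rintro a ⟨z, hz, hza⟩ b ⟨z', hz', hzb⟩ hab
    have hcl : close z z' := by
      have h1 := hza.norm_le hpos
      have h2 := hzb.norm_le hpos
      simp only [hclose]
      have : ((z : E) - z') = (z - a) + (a - b) + -(z' - b) := by abel
      rw [this]
      refine (norm_add₃_le).trans ?_
      rw [norm_neg]
      linarith
    have j1 := (hstep z hz a hza).symm
    have j2 := hconn _ _ _ (hZZ z hz z' hz' hcl)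
    have j3 := hstep z' hz' b hzb
    refine (Joined'.trans (by positivity) hpos (Joined'.trans hpos (by positivity) j1 j2) j3).le ?_
    linarith

/-! ### Small quasiconvex neighbourhoods -/

theorem exists_small_nhd {E : Type*} [NormedAddCommGroup E] [NormedSpace ℝ E]
    [FiniteDimensional ℝ E] (Y : Set E) (Λ : ℝ) (hΛ : 1 ≤ Λ)
    (hY : ∀ a ∈ Y, ∀ b ∈ Y, Joined' Y a b (Λ * ‖a - b‖)) (y : E) (hy : y ∈ Y)
    (R : ℝ) (hR : 0 < R) :
    ∃ O : Set E, IsOpen O ∧ y ∈ O ∧ Y ∩ O ⊆ ball y R ∧ ∃ L : ℝ, 1 ≤ L ∧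
      ∀ a ∈ Y ∩ O, ∀ b ∈ Y ∩ O, Joined' (Y ∩ O) a b (L * ‖a - b‖) := by
  obtain ⟨C, D, hC, hD, hstep⟩ := exists_step Y Λ hΛ hY
  set q : ℝ := 1 / (4 * C) with hq
  have hC0 : 0 < C := by linarith
  have hq0 : 0 < q := by positivity
  have hqC : 4 * C * q = 1 := by rw [hq]; field_simp
  have hq2 : q ≤ 1 / 2 := by nlinarith
  set r : ℕ → ℝ := fun k => R / (4 * C) * q ^ k with hr
  have hr0 : ∀ k, 0 < r k := fun k => by simp only [hr]; positivity
  have hrs : ∀ k, r (k + 1) = q * r k := fun k => by simp only [hr]; ring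
  obtain ⟨W, hW0, hWY, hW1, hW2, hW3⟩ : ∃ W : ℕ → Set E, W 0 = {y} ∧ (∀ k, W k ⊆ Y) ∧
      (∀ k, ∀ w ∈ W k, ∀ x ∈ Y, ‖x - w‖ ≤ r k → x ∈ W (k + 1)) ∧
      (∀ k, ∀ x ∈ W (k + 1), ∃ w ∈ W k, Joined' (W (k + 1)) x w (C * r k)) ∧
      (∀ k, ∀ a ∈ W (k + 1), ∀ b ∈ W (k + 1), ‖a - b‖ ≤ 2 * r k →
        Joined' (W (k + 1)) a b (D * r k)) := by
    choose! F hFY hF using hstep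
    let W : ℕ → {W : Set E // W ⊆ Y} := fun n => Nat.rec ⟨{y}, by simpa using hy⟩
      (fun k V => ⟨F (r k) V.1, hFY (r k) (hr0 k) V.1 V.2⟩) n
    exact ⟨fun n => (W n).1, rfl, fun k => (W k).2, fun k => (hF (r k) (hr0 k) _ (W k).2).1,
      fun k => (hF (r k) (hr0 k) _ (W k).2).2.1, fun k => (hF (r k) (hr0 k) _ (W k).2).2.2⟩
  have hmono : Monotone W := monotone_nat_of_le_succ fun k w hw =>
    hW1 k w hw w (hWY k hw) (by simpa using (hr0 k).le)
  set V : Set E := ⋃ k, W k with hV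
  have hWV : ∀ k, W k ⊆ V := fun k => subset_iUnion W k
  have hdesc : ∀ n j, ∀ x ∈ W (j + n), ∃ w ∈ W j, Joined' V x w (2 * C * r j) := by
    intro n
    induction n with
    | zero => exact fun j x hx => ⟨x, hx, Joined'.refl (hWV _ hx) _⟩
    | succ n ih =>
      intro j x hx
      have hx' : x ∈ W ((j + 1) + n) := by
        rwa [show j + 1 + n = j + (n + 1) by omega]
      obtain ⟨w1, hw1, j1⟩ := ih (j + 1) x hx'
      obtain ⟨w, hw, j2⟩ := hW2 j w1 hw1
      refine ⟨w, hw, (Joined'.trans (by have := hr0 (j+1); positivity)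
        (by have := hr0 j; positivity) j1 (j2.mono (hWV _))).le ?_⟩
      rw [hrs]
      have := hr0 j
      have : q * (C * r j) ≤ 1 / 2 * (C * r j) := by gcongr
      linarith
  have hdescV : ∀ x ∈ V, ∀ j, ∃ w ∈ W j, Joined' V x w (2 * C * r j) := by
    intro x hx j
    obtain ⟨k, hk⟩ := mem_iUnion.1 hx
    exact hdesc k j x (hmono (by omega) hk)
  have hr00 : r 0 = R / (4 * C) := by simp [hr]
  have hdy : ∀ x ∈ V, Joined' V x y (2 * C * r 0) := by
    intro x hx
    obtain ⟨w, hw, j⟩ := hdescV x hx 0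
    rw [hW0] at hw
    rwa [mem_singleton_iff.1 hw] at j
  set O : Set E := ⋃ k, ⋃ w ∈ W k, ball w (r k) with hO
  have hYO : Y ∩ O = V := by
    apply Subset.antisymm
    · rintro x ⟨hx, hxO⟩
      simp only [hO, mem_iUnion] at hxO
      obtain ⟨k, w, hw, hb⟩ := hxO
      refine hWV (k + 1) (hW1 k w hw x hx ?_)
      rw [mem_ball, dist_eq_norm] at hb
      exact hb.le
    · intro x hx
      obtain ⟨k, hk⟩ := mem_iUnion.1 hx
      refine ⟨hWY k hk, ?_⟩
      simp only [hO, mem_iUnion]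
      exact ⟨k, x, hk, mem_ball_self (hr0 k)⟩
  have hyV : y ∈ V := hWV 0 (by rw [hW0]; rfl)
  refine ⟨O, isOpen_iUnion fun k => isOpen_biUnion fun w _ => isOpen_ball, ?_, ?_, ?_⟩
  · rw [← hYO] at hyV; exact hyV.2
  · rw [hYO]
    intro x hx
    have h1 := (hdy x hx).norm_le (by have := hr0 0; positivity)
    rw [mem_ball, dist_eq_norm]
    rw [hr00] at h1
    have h2 : 2 * C * (R / (4 * C)) = R / 2 := by field_simp; norm_num
    linarith
  · rw [hYO]
    refine ⟨4 * C + D / q, ?_, ?_⟩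
    · have : 0 < D / q := by positivity
      linarith
    intro a ha b hb
    have hDq : 0 < D / q := by positivity
    by_cases hab : a = b
    · subst hab; exact Joined'.refl ha _
    have hd0 : 0 < ‖a - b‖ := norm_pos_iff.2 (sub_ne_zero.2 hab)
    by_cases hd : ‖a - b‖ ≤ r 0
    · have hR0 : 0 < r 0 := hr0 0
      obtain ⟨j, hj1, hj2⟩ := exists_nat_pow_near_of_lt_one (x := ‖a - b‖ / r 0) (y := q)
        (by positivity) ((div_le_one hR0).2 hd) hq0 (by linarith)
      rw [lt_div_iff₀ hR0] at hj1
      rw [div_le_iff₀ hR0] at hj2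
      have e1 : q ^ (j + 1) * r 0 = r (j + 1) := by simp only [hr]; ring
      have e2 : q ^ j * r 0 = r j := by simp only [hr]; ring
      rw [e1] at hj1
      rw [e2] at hj2
      obtain ⟨a', ha', ja⟩ := hdescV a ha (j + 1)
      obtain ⟨b', hb', jb⟩ := hdescV b hb (j + 1)
      have hpos : 0 ≤ 2 * C * r (j + 1) := by have := hr0 (j + 1); positivity
      have hrj := hr0 j
      have e3 : 4 * C * r (j + 1) = r j := by
        rw [hrs, ← mul_assoc, hqC, one_mul]
      have hab' : ‖a' - b'‖ ≤ 2 * r j := by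
        have h1 := ja.norm_le hpos
        have h2 := jb.norm_le hpos
        have : a' - b' = -(a - a') + (a - b) + (b - b') := by abel
        rw [this]
        refine (norm_add₃_le).trans ?_
        rw [norm_neg]
        linarith
      have jm := (hW3 j a' ha' b' hb' hab').mono (hWV _)
      refine (Joined'.trans (by positivity) hpos (Joined'.trans hpos (by positivity) ja jm)
        jb.symm).le ?_
      have e4 : D * r j = D / q * r (j + 1) := by rw [hrs]; field_simp
      rw [e4]
      have : (4 * C + D / q) * r (j + 1) ≤ (4 * C + D / q) * ‖a - b‖ := by gcongr
      linarith
    · push Not at hd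
      have hpos : 0 ≤ 2 * C * r 0 := by have := hr0 0; positivity
      refine (Joined'.trans hpos hpos (hdy a ha) (hdy b hb).symm).le ?_
      have h1 : (4 * C + D / q) * r 0 ≤ (4 * C + D / q) * ‖a - b‖ := by gcongr
      have h2 : 0 < D / q * r 0 := mul_pos hDq (hr0 0)
      linarith

theorem joined_of_innerDist {E : Type*} [NormedAddCommGroup E] {Y : Set E} {lam : ℝ}
    (hlam : 1 ≤ lam)
    (h : ∀ a ∈ Y, ∀ b ∈ Y, innerDist Y a b ≤ ENNReal.ofReal (lam * ‖a - b‖)) :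
    ∀ a ∈ Y, ∀ b ∈ Y, Joined' Y a b ((2 * lam) * ‖a - b‖) := by
  intro a ha b hb
  by_cases hab : a = b
  · subst hab; exact Joined'.refl ha _
  have hd0 : 0 < ‖a - b‖ := norm_pos_iff.2 (sub_ne_zero.2 hab)
  have h1 : innerDist Y a b < ENNReal.ofReal ((2 * lam) * ‖a - b‖) := by
    refine (h a ha b hb).trans_lt ((ENNReal.ofReal_lt_ofReal_iff (by positivity)).2 ?_)
    have : 0 < lam * ‖a - b‖ := by positivity
    linarith
  unfold innerDist at h1
  simp only [iInf_lt_iff] at h1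
  obtain ⟨γ, hγ, h2⟩ := h1
  exact ⟨γ, hγ, h2.le⟩

theorem innerDist_le_of_joined {E : Type*} [NormedAddCommGroup E] {Y : Set E} {a b : E} {l : ℝ}
    (h : Joined' Y a b l) : innerDist Y a b ≤ ENNReal.ofReal l := by
  obtain ⟨γ, hγ, h2⟩ := h
  exact (iInf₂_le γ hγ).trans h2

theorem Joined'.image {E : Type*} [NormedAddCommGroup E] {Y Y' : Set E} {a b : E} {l K : ℝ}
    (hK : 0 ≤ K) (g : E → E) (hg : ∀ u ∈ Y, ∀ v ∈ Y, ‖g u - g v‖ ≤ K * ‖u - v‖)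
    (hm : MapsTo g Y Y') (h : Joined' Y a b l) : Joined' Y' (g a) (g b) (K * l) := by
  obtain ⟨γ, ⟨h1, h2, h3, h4⟩, h5⟩ := h
  have hlip : LipschitzOnWith K.toNNReal g Y := by
    apply LipschitzOnWith.of_dist_le_mul
    intro u hu v hv
    rw [dist_eq_norm, dist_eq_norm, Real.coe_toNNReal K hK]
    exact hg u hu v hv
  refine ⟨g ∘ γ, ⟨hlip.continuousOn.comp h1 h2, hm.comp h2, by simp [h3], by simp [h4]⟩, ?_⟩
  refine (hlip.comp_eVariationOn_le h2).trans ?_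
  rw [ENNReal.ofReal_mul hK]
  exact mul_le_mul_right h5 _

theorem lneat_of_equiv {E : Type*} [NormedAddCommGroup E] [NormedSpace ℝ E]
    [FiniteDimensional ℝ E] (X : Set E) (y y' : E) (hyX : y ∈ X) (U : Set E) (hU : IsOpen U)
    (hy' : y' ∈ X ∩ U) (lam : ℝ) (hlam : 1 ≤ lam)
    (h : ∀ a ∈ X ∩ U, ∀ b ∈ X ∩ U, innerDist (X ∩ U) a b ≤ ENNReal.ofReal (lam * ‖a - b‖))
    (he : GermBilipschitzEquiv X y y') : LNEat X y := by
  obtain ⟨V, V', hV, hV', hyV, hyV', f, hfy, hbij, K, hK, hf⟩ := he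
  obtain ⟨R, hR, hball⟩ := Metric.isOpen_iff.1 hV' y' hyV'
  obtain ⟨O, hO, hyO, hOR, L, hL, hj⟩ := exists_small_nhd (X ∩ U) (2 * lam) (by linarith)
    (joined_of_innerDist hlam h) y' hy' R hR
  have hK0 : 0 ≤ K := by linarith
  have hlip : LipschitzOnWith K.toNNReal f (X ∩ V) := by
    apply LipschitzOnWith.of_dist_le_mul
    intro u hu v hv
    rw [dist_eq_norm, dist_eq_norm, Real.coe_toNNReal K hK0]
    exact (hf u hu v hv).1
  obtain ⟨T, hT, hTeq⟩ := (_root_.continuousOn_iff'.1 hlip.continuousOn) (U ∩ O) (hU.inter hO)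
  have hmem : ∀ x, x ∈ X ∩ (T ∩ V) ↔ x ∈ X ∩ V ∧ f x ∈ U ∩ O := by
    intro x
    have := Set.ext_iff.1 hTeq x
    simp only [mem_inter_iff, mem_preimage] at this ⊢
    tauto
  have hinv : ∀ z ∈ X ∩ U ∩ O, ∃ x, x ∈ X ∩ (T ∩ V) ∧ f x = z := by
    intro z hz
    obtain ⟨x, hx, rfl⟩ := hbij.surjOn (⟨hz.1.1, hball (hOR hz)⟩ : z ∈ X ∩ V')
    exact ⟨x, (hmem x).2 ⟨hx, hz.1.2, hz.2⟩, rfl⟩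
  choose! g hg1 hg2 using hinv
  have hfm : ∀ x ∈ X ∩ (T ∩ V), f x ∈ X ∩ U ∩ O := by
    intro x hx
    have h1 := (hmem x).1 hx
    exact ⟨⟨(hbij.mapsTo h1.1).1, h1.2.1⟩, h1.2.2⟩
  have hgf : ∀ x ∈ X ∩ (T ∩ V), g (f x) = x := by
    intro x hx
    exact hbij.injOn ((hmem _).1 (hg1 _ (hfm x hx))).1 ((hmem x).1 hx).1 (hg2 _ (hfm x hx))
  have hyT : y ∈ X ∩ (T ∩ V) := (hmem y).2 ⟨⟨hyX, hyV⟩, by rw [hfy]; exact ⟨hy'.2, hyO⟩⟩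
  refine ⟨T ∩ V, hT.inter hV, hyT.2, K * (L * K), ?_, ?_⟩
  · have : 1 ≤ L * K := one_le_mul_of_one_le_of_one_le hL hK
    exact one_le_mul_of_one_le_of_one_le hK this
  intro a ha b hb
  have j := Joined'.image (Y' := X ∩ (T ∩ V)) hK0 g (by
    intro u hu v hv
    have h1 := (hf _ ((hmem _).1 (hg1 u hu)).1 _ ((hmem _).1 (hg1 v hv)).1).2
    rwa [hg2 u hu, hg2 v hv] at h1) (fun z hz => hg1 z hz) (hj _ (hfm a ha) _ (hfm b hb))
  rw [hgf a ha, hgf b hb] at j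
  refine innerDist_le_of_joined (j.le ?_)
  have h1 := (hf a ((hmem a).1 ha).1 b ((hmem b).1 hb).1).1
  have hL0 : 0 ≤ L := by linarith
  calc K * (L * ‖f a - f b‖) ≤ K * (L * (K * ‖a - b‖)) := by gcongr
    _ = K * (L * K) * ‖a - b‖ := by ring

/-- if `(X, 0)` is Lipschitz normally embedded and
`X ∩ B_ε = ⊔_{i ∈ A} S_i` is a finite Lipschitz stratification (the bilipschitz type of
`(X, y)` being constant along each stratum, and `0 ∈ closure (S i)`), then `(X, y)` is
Lipschitz normally embedded for every `y` in every stratum. -/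
theorem stmt18 {m : ℕ} (X : Set (EuclideanSpace ℝ (Fin m)))
    (h0 : (0 : EuclideanSpace ℝ (Fin m)) ∈ X)
    (ε : ℝ) (hε : 0 < ε)
    (A : Type*) [Finite A] (S : A → Set (EuclideanSpace ℝ (Fin m)))
    (hcover : X ∩ Metric.ball 0 ε = ⋃ i, S i)
    (hdisj : Pairwise (Function.onFun Disjoint S))
    (hcl : ∀ i, (0 : EuclideanSpace ℝ (Fin m)) ∈ closure (S i))
    (hconst : ∀ i, ∀ y ∈ S i, ∀ y' ∈ S i, GermBilipschitzEquiv X y y')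
    (hne : LNEat X 0) :
    ∀ i, ∀ y ∈ S i, LNEat X y := by
  intro i y hy
  obtain ⟨U, hU, h0U, lam, hlam, h⟩ := hne
  have hSX : ∀ z ∈ S i, z ∈ X := by
    intro z hz
    have : z ∈ X ∩ Metric.ball 0 ε := by
      rw [hcover]
      exact mem_iUnion.2 ⟨i, hz⟩
    exact this.1
  obtain ⟨y', hy'U, hy'S⟩ := mem_closure_iff.1 (hcl i) U hU h0U
  exact lneat_of_equiv X y y' (hSX y hy) U hU ⟨hSX y' hy'S, hy'U⟩ lam hlam h (hconst i y hy y' hy'S)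
end
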